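/- arXiv:2101.11300 — 7 statements merged into one kernel-verified Lean document; each statement's English description precedes it below -/
import Mathlib

section
/- Let (V,c,s,t) be a flow network, let ρ be a feasible preflow, and let h be a labeling that is valid with respect to ρ. Then there is no residual path from s to t with respect to ρ. -/
open Finset

/-- The excess of a vertex `v` under `ρ`: total flow into `v` minus total flow out of `v`. -/
def ex {V : Type*} [Fintype V] (ρ : V → V → ℝ) (v : V) : ℝ :=
  (∑ u, ρ u v) - (∑ u, ρ v u)

/-- Residual capacity of the arc `(u,v)` with respect to capacities `c` and preflow `ρ`. -/
def cRes {V : Type*} (c ρ : V → V → ℝ) (u v : V) : ℝ :=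
  c u v - ρ u v + ρ v u

/-- A residual path from `a` to `b` with respect to `ρ`. -/
def ResPath {V : Type*} (c ρ : V → V → ℝ) (a b : V) : Prop :=
  ∃ (m : ℕ) (p : ℕ → V), p 0 = a ∧ p m = b ∧ ∀ i < m, 0 < cRes c ρ (p i) (p (i + 1))

/-- If `ρ` is a feasible preflow and `h` is a valid labeling with respect to `ρ`,
then there is no residual path from the source `s` to the sink `t`. -/
theorem stmt0 {V : Type*} [Fintype V] (c ρ : V → V → ℝ) (s t : V) (h : V → ℕ)
    (hst : s ≠ t)
    (hc : ∀ u v, 0 ≤ c u v)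
    (hρ : ∀ u v, 0 ≤ ρ u v ∧ ρ u v ≤ c u v)
    (hfeas : ∀ v, v ≠ s → 0 ≤ ex ρ v)
    (hhs : h s = Fintype.card V) (hht : h t = 0)
    (hvalid : ∀ u v, 0 < cRes c ρ u v → h u ≤ h v + 1) :
    ¬ ResPath c ρ s t := by
  rintro ⟨m, p, hp0, hpm, hp⟩
  have key : ∀ i, i ≤ m → ∀ k, h (p i) ≤ k → k ≤ h s → ∃ v, h v = k := by
    intro i
    induction i with
    | zero =>
      intro _ k h1 h2
      rw [hp0] at h1
      exact ⟨s, le_antisymm h1 h2⟩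
    | succ i ih =>
      intro hi k h1 h2
      rcases Nat.eq_or_lt_of_le h1 with h3 | h3
      · exact ⟨_, h3⟩
      · have h4 := hvalid _ _ (hp i (by omega))
        exact ih (by omega) k (by omega) h2
  have hsub : Finset.range (Fintype.card V + 1) ⊆ Finset.univ.image h := by
    intro k hk
    rw [Finset.mem_range] at hk
    obtain ⟨v, hv⟩ := key m le_rfl k (by rw [hpm, hht]; exact Nat.zero_le k) (by omega)
    exact Finset.mem_image.2 ⟨v, Finset.mem_univ v, hv⟩
  have h1 := Finset.card_le_card hsub
  have h2 : (Finset.univ.image h).card ≤ Fintype.card V := Finset.card_image_le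
  rw [Finset.card_range] at h1
  omega
end

section
/- Let (V,c,s,t) be a flow network and let ρ be a feasible preflow. Then for every vertex v with ex(ρ,v) > 0 there exists a residual path from v to s with respect to ρ. -/
open Finset

theorem resPath_snoc {V : Type*} (c ρ : V → V → ℝ) (a b w : V) (h : ResPath c ρ a b)
    (hw : 0 < cRes c ρ b w) : ResPath c ρ a w := by
  obtain ⟨m, p, h0, hm, hp⟩ := h
  refine ⟨m + 1, fun i => if i ≤ m then p i else w, by simpa using h0, by simp, ?_⟩
  intro i hi
  rcases Nat.lt_or_ge i m with h | h
  · have h1 : i ≤ m := by omega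
    have h2 : i + 1 ≤ m := by omega
    simpa [h1, h2] using hp i h
  · have h1 : i = m := by omega
    subst h1
    simpa [hm] using hw

/-- If `ρ` is a feasible preflow, then from every vertex of positive excess
there is a residual path back to the source `s`. -/
theorem stmt1 {V : Type*} [Fintype V] (c ρ : V → V → ℝ) (s t : V)
    (hst : s ≠ t)
    (hc : ∀ u v, 0 ≤ c u v)
    (hρ : ∀ u v, 0 ≤ ρ u v ∧ ρ u v ≤ c u v)
    (hfeas : ∀ v, v ≠ s → 0 ≤ ex ρ v) :
    ∀ v, 0 < ex ρ v → ResPath c ρ v s := by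
  classical
  intro v hv
  by_contra hs
  let S : Finset V := Finset.univ.filter (fun x => ResPath c ρ v x)
  have hvS : v ∈ S := by
    simp only [S, Finset.mem_filter, Finset.mem_univ, true_and]
    exact ⟨0, fun _ => v, rfl, rfl, by simp⟩
  have hsS : ∀ x ∈ S, x ≠ s := by
    rintro x hx rfl
    exact hs (by simpa [S] using hx)
  have hpos : 0 < ∑ x ∈ S, ex ρ x :=
    Finset.sum_pos' (fun x hx => hfeas x (hsS x hx)) ⟨v, hvS, hv⟩
  have hout : ∀ x ∈ S, ∀ u ∈ Sᶜ, ρ u x - ρ x u ≤ 0 := by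
    intro x hx u hu
    by_contra hcon
    have hxr : ResPath c ρ v x := by simpa [S] using hx
    have hur : ¬ ResPath c ρ v u := by simpa [S] using hu
    apply hur
    apply resPath_snoc c ρ v x u hxr
    have := hc x u
    unfold cRes
    linarith
  have hsplit : ∀ x, ex ρ x = (∑ u ∈ S, ρ u x - ∑ u ∈ S, ρ x u)
      + ∑ u ∈ Sᶜ, (ρ u x - ρ x u) := by
    intro x
    unfold ex
    rw [← Finset.sum_add_sum_compl S, ← Finset.sum_add_sum_compl S (fun u => ρ x u),
      Finset.sum_sub_distrib]
    ring
  have hneg : ∑ x ∈ S, ∑ u ∈ Sᶜ, (ρ u x - ρ x u) ≤ 0 :=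
    Finset.sum_nonpos fun x hx => Finset.sum_nonpos fun u hu => hout x hx u hu
  have hcomm : ∑ x ∈ S, ∑ u ∈ S, ρ u x = ∑ x ∈ S, ∑ u ∈ S, ρ x u := Finset.sum_comm
  rw [Finset.sum_congr rfl (fun x _ => hsplit x), Finset.sum_add_distrib,
    Finset.sum_sub_distrib, hcomm] at hpos
  linarith
end

section
/- Let (V,c,s,t) be a flow network, let ρ be a feasible preflow, and let h be a labeling that is valid with respect to ρ. Then every vertex v with ex(ρ,v) > 0 satisfies h(v) ≤ 2|V| − 1. -/
open Finset

/-- If `ρ` is a feasible preflow and `h` is a valid labeling with respect to `ρ`,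
then every vertex of positive excess has label at most `2·|V| − 1`. -/
theorem stmt2 {V : Type*} [Fintype V] (c ρ : V → V → ℝ) (s t : V) (h : V → ℕ)
    (hst : s ≠ t)
    (hc : ∀ u v, 0 ≤ c u v)
    (hρ : ∀ u v, 0 ≤ ρ u v ∧ ρ u v ≤ c u v)
    (hfeas : ∀ v, v ≠ s → 0 ≤ ex ρ v)
    (hhs : h s = Fintype.card V) (hht : h t = 0)
    (hvalid : ∀ u v, 0 < cRes c ρ u v → h u ≤ h v + 1) :
    ∀ v, 0 < ex ρ v → h v ≤ 2 * Fintype.card V - 1 := by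
  classical
  intro v hv
  by_contra hlt
  have hn : 0 < Fintype.card V := Fintype.card_pos_iff.mpr ⟨s⟩
  -- a level strictly between `|V|` and `2|V|` carries no vertex
  obtain ⟨k, hk1, hk2, hk⟩ :
      ∃ k, Fintype.card V < k ∧ k < 2 * Fintype.card V ∧ ∀ u, h u ≠ k := by
    by_contra hcon
    push Not at hcon
    have hsub : insert (h v) (Finset.Ico (Fintype.card V) (2 * Fintype.card V)) ⊆
        Finset.univ.image h := by
      intro k hk
      rw [Finset.mem_image]
      rcases Finset.mem_insert.mp hk with rfl | hk
      · exact ⟨v, Finset.mem_univ _, rfl⟩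
      · rw [Finset.mem_Ico] at hk
        rcases Nat.eq_or_lt_of_le hk.1 with he | hl
        · exact ⟨s, Finset.mem_univ _, hhs.trans he⟩
        · obtain ⟨u, hu⟩ := hcon k hl hk.2
          exact ⟨u, Finset.mem_univ _, hu⟩
    have h1 := (Finset.card_le_card hsub).trans Finset.card_image_le
    rw [Finset.card_insert_of_notMem (by rw [Finset.mem_Ico]; omega), Nat.card_Ico,
      Finset.card_univ] at h1
    omega
  -- the vertices above that level receive no flow from outside
  set S : Finset V := Finset.univ.filter (fun u => k < h u) with hS
  have hzero : ∀ u ∈ S, ∀ w, w ∉ S → ρ w u = 0 := by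
    intro u hu w hw
    simp only [hS, Finset.mem_filter, Finset.mem_univ, true_and] at hu hw
    have hne := hk w
    have hr : ¬ 0 < cRes c ρ u w := fun hp => by
      have := hvalid u w hp
      omega
    unfold cRes at hr
    have h1 := hρ u w
    have h2 := hρ w u
    linarith [h1.2, h2.1]
  have hle : ∑ u ∈ S, ex ρ u ≤ 0 := by
    have h1 : ∀ u ∈ S, ex ρ u ≤ (∑ w ∈ S, ρ w u) - ∑ w ∈ S, ρ u w := by
      intro u hu
      unfold ex
      have e1 : ∑ w ∈ S, ρ w u = ∑ w, ρ w u :=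
        Finset.sum_subset (Finset.subset_univ _) (fun w _ hw => hzero u hu w hw)
      have e2 : ∑ w ∈ S, ρ u w ≤ ∑ w, ρ u w :=
        Finset.sum_le_sum_of_subset_of_nonneg (Finset.subset_univ _)
          (fun w _ _ => (hρ u w).1)
      linarith
    refine (Finset.sum_le_sum h1).trans ?_
    rw [Finset.sum_sub_distrib, Finset.sum_comm, sub_self]
  have hvS : v ∈ S := by
    simp only [hS, Finset.mem_filter, Finset.mem_univ, true_and]
    omega
  have hpos : 0 < ∑ u ∈ S, ex ρ u := by
    refine Finset.sum_pos' (fun u hu => hfeas u ?_) ⟨v, hvS, hv⟩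
    rintro rfl
    simp only [hS, Finset.mem_filter, Finset.mem_univ, true_and] at hu
    omega
  exact absurd hpos (not_lt.mpr hle)
end

section
/- Let (V,c,s,t) be a flow network, let ρ be a feasible preflow, and let h be a labeling valid with respect to ρ. Let u, v be vertices with ex(ρ,u) > 0, c_ρ(u,v) > 0 and h(u) = h(v) + 1, and set δ = min(ex(ρ,u), c_ρ(u,v)). Define ρ' by ρ'(v,u) = ρ(v,u) − min(δ, ρ(v,u)), ρ'(u,v) = ρ(u,v) + (δ − min(δ, ρ(v,u))), and ρ'(x,y) = ρ(x,y) for all other pairs (x,y). Then: (a) ρ' is a feasible preflow; (b) c_{ρ'}(u,v) = c_ρ(u,v) − δ and c_{ρ'}(v,u) = c_ρ(v,u) + δ, and c_{ρ'} agrees with c_ρ on all other pairs; (c) ex(ρ',u) = ex(ρ,u) − δ, ex(ρ',v) = ex(ρ,v) + δ, and ex(ρ',x) = ex(ρ,x) for x ∉ {u,v}; (d) h is valid with respect to ρ'; and (e) either c_{ρ'}(u,v) = 0 or ex(ρ',u) = 0. -/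
open Finset

/-- Correctness of the `Push(u,v)` operation of the Push-Relabel algorithm. -/
theorem stmt3 {V : Type*} [Fintype V] (c ρ : V → V → ℝ) (s t : V) (h : V → ℕ)
    (hst : s ≠ t)
    (hc : ∀ u v, 0 ≤ c u v)
    (hρ : ∀ u v, 0 ≤ ρ u v ∧ ρ u v ≤ c u v)
    (hfeas : ∀ v, v ≠ s → 0 ≤ ex ρ v)
    (hhs : h s = Fintype.card V) (hht : h t = 0)
    (hvalid : ∀ a b, 0 < cRes c ρ a b → h a ≤ h b + 1)
    (u v : V)
    (hexu : 0 < ex ρ u)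
    (hres : 0 < cRes c ρ u v)
    (hhuv : h u = h v + 1)
    (δ : ℝ) (hδ : δ = min (ex ρ u) (cRes c ρ u v))
    (ρ' : V → V → ℝ)
    (hρ'vu : ρ' v u = ρ v u - min δ (ρ v u))
    (hρ'uv : ρ' u v = ρ u v + (δ - min δ (ρ v u)))
    (hρ'other : ∀ x y, (x, y) ≠ (u, v) → (x, y) ≠ (v, u) → ρ' x y = ρ x y) :
    -- (a) ρ' is a feasible preflow
    ((∀ x y, 0 ≤ ρ' x y ∧ ρ' x y ≤ c x y) ∧ (∀ w, w ≠ s → 0 ≤ ex ρ' w)) ∧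
    -- (b) residual capacities change only on (u,v) and (v,u)
    (cRes c ρ' u v = cRes c ρ u v - δ ∧ cRes c ρ' v u = cRes c ρ v u + δ ∧
      ∀ x y, (x, y) ≠ (u, v) → (x, y) ≠ (v, u) → cRes c ρ' x y = cRes c ρ x y) ∧
    -- (c) excesses change only at u and v
    (ex ρ' u = ex ρ u - δ ∧ ex ρ' v = ex ρ v + δ ∧
      ∀ x, x ≠ u → x ≠ v → ex ρ' x = ex ρ x) ∧
    -- (d) h is still a valid labeling with respect to ρ'
    (h s = Fintype.card V ∧ h t = 0 ∧ ∀ a b, 0 < cRes c ρ' a b → h a ≤ h b + 1) ∧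
    -- (e) either the arc (u,v) is saturated or u is inactive
    (cRes c ρ' u v = 0 ∨ ex ρ' u = 0) := by
  classical
  have huv : u ≠ v := by
    rintro rfl
    omega
  have hvu : v ≠ u := huv.symm
  set m := min δ (ρ v u) with hm
  have hδ0 : 0 < δ := by rw [hδ]; exact lt_min hexu hres
  have hδ1 : δ ≤ ex ρ u := by rw [hδ]; exact min_le_left _ _
  have hδ2 : δ ≤ cRes c ρ u v := by rw [hδ]; exact min_le_right _ _
  have hm1 : m ≤ δ := min_le_left _ _
  have hm2 : m ≤ ρ v u := min_le_right _ _
  have hm0 : 0 ≤ m := le_min hδ0.le (hρ v u).1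
  have hform : ∀ x y, ρ' x y = ρ x y + (if x = u then (if y = v then δ - m else 0) else 0)
      - (if x = v then (if y = u then m else 0) else 0) := by
    intro x y
    by_cases h1 : x = u ∧ y = v
    · obtain ⟨rfl, rfl⟩ := h1
      simp [hρ'uv, huv]
    · by_cases h2 : x = v ∧ y = u
      · obtain ⟨rfl, rfl⟩ := h2
        simp [hρ'vu, huv, hvu]
      · rw [hρ'other x y (by simpa using h1) (by simpa using h2)]
        have e1 : (if x = u then (if y = v then δ - m else 0) else 0) = 0 := by
          split_ifs <;> tauto
        have e2 : (if x = v then (if y = u then m else 0) else 0) = 0 := by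
          split_ifs <;> tauto
        rw [e1, e2]; ring
  have hex : ∀ w, ex ρ' w = ex ρ w + (if w = v then δ else 0) - (if w = u then δ else 0) := by
    intro w
    unfold ex
    simp only [hform, Finset.sum_add_distrib, Finset.sum_sub_distrib]
    by_cases h1 : w = u
    · subst h1
      simp [huv]
      ring
    · by_cases h2 : w = v
      · subst h2
        simp [h1]
        ring
      · simp [h1, h2]
  have hb1 : cRes c ρ' u v = cRes c ρ u v - δ := by
    unfold cRes; rw [hρ'uv, hρ'vu]; ring
  have hb2 : cRes c ρ' v u = cRes c ρ v u + δ := by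
    unfold cRes; rw [hρ'uv, hρ'vu]; ring
  have hb3 : ∀ x y, (x, y) ≠ (u, v) → (x, y) ≠ (v, u) → cRes c ρ' x y = cRes c ρ x y := by
    intro x y h1 h2
    unfold cRes
    rw [hρ'other x y h1 h2, hρ'other y x (by simp at *; tauto) (by simp at *; tauto)]
  have hc1 : ex ρ' u = ex ρ u - δ := by simp [hex, huv]
  have hc2 : ex ρ' v = ex ρ v + δ := by simp [hex, hvu]
  have hc3 : ∀ x, x ≠ u → x ≠ v → ex ρ' x = ex ρ x := by
    intro x h1 h2; simp [hex, h1, h2]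
  refine ⟨⟨?_, ?_⟩, ⟨hb1, hb2, hb3⟩, ⟨hc1, hc2, hc3⟩, ⟨hhs, hht, ?_⟩, ?_⟩
  · intro x y
    by_cases h1 : (x, y) = (u, v)
    · obtain ⟨rfl, rfl⟩ := Prod.mk.inj h1
      rw [hρ'uv]
      refine ⟨by linarith [(hρ x y).1], ?_⟩
      rcases min_choice δ (ρ y x) with h3 | h3
      · rw [hm, h3]; linarith [(hρ x y).2]
      · rw [hm, h3]; unfold cRes at hδ2; linarith
    · by_cases h2 : (x, y) = (v, u)
      · obtain ⟨rfl, rfl⟩ := Prod.mk.inj h2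
        rw [hρ'vu]
        exact ⟨by linarith, by linarith [(hρ x y).2]⟩
      · rw [hρ'other x y h1 h2]; exact hρ x y
  · intro w hw
    by_cases h1 : w = u
    · rw [h1, hc1]; linarith
    · by_cases h2 : w = v
      · have := hfeas w hw
        rw [h2] at this ⊢
        rw [hc2]; linarith
      · rw [hc3 w h1 h2]; exact hfeas w hw
  · intro a b hab
    by_cases h1 : (a, b) = (u, v)
    · obtain ⟨rfl, rfl⟩ := Prod.mk.inj h1
      omega
    · by_cases h2 : (a, b) = (v, u)
      · obtain ⟨rfl, rfl⟩ := Prod.mk.inj h2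
        omega
      · rw [hb3 a b h1 h2] at hab
        exact hvalid a b hab
  · rcases min_choice (ex ρ u) (cRes c ρ u v) with h3 | h3
    · right; rw [hc1, hδ, h3]; ring
    · left; rw [hb1, hδ, h3]; ring
end

section
/- Let (V,c,s,t) be a flow network, let ρ be a feasible preflow, and let h be a labeling valid with respect to ρ. Let u ∉ {s,t} be a vertex with ex(ρ,u) > 0 such that the set R = {v : c_ρ(u,v) > 0} is nonempty and h(u) ≤ h(v) for every v ∈ R. Define h' by h'(u) = 1 + min{h(v) : v ∈ R} and h'(x) = h(x) for x ≠ u. Then h' is a valid labeling with respect to ρ and h'(u) > h(u). -/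
open Finset

/-- Correctness of the `Relabel(u)` operation of the Push-Relabel algorithm. -/
theorem stmt4 {V : Type*} [Fintype V] (c ρ : V → V → ℝ) (s t : V) (h : V → ℕ)
    (hst : s ≠ t)
    (hc : ∀ u v, 0 ≤ c u v)
    (hρ : ∀ u v, 0 ≤ ρ u v ∧ ρ u v ≤ c u v)
    (hfeas : ∀ v, v ≠ s → 0 ≤ ex ρ v)
    (hhs : h s = Fintype.card V) (hht : h t = 0)
    (hvalid : ∀ a b, 0 < cRes c ρ a b → h a ≤ h b + 1)
    (u : V) (hus : u ≠ s) (hut : u ≠ t)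
    (hexu : 0 < ex ρ u)
    (hRne : ∃ v, 0 < cRes c ρ u v)
    (hmin : ∀ v, 0 < cRes c ρ u v → h u ≤ h v)
    (h' : V → ℕ)
    (hh'u : h' u = 1 + sInf {n : ℕ | ∃ v, 0 < cRes c ρ u v ∧ h v = n})
    (hh'x : ∀ x, x ≠ u → h' x = h x) :
    (h' s = Fintype.card V ∧ h' t = 0 ∧ ∀ a b, 0 < cRes c ρ a b → h' a ≤ h' b + 1) ∧
    h u < h' u := by
  have hlt : h u < h' u := by
    have hmem := Nat.sInf_mem (s := {n : ℕ | ∃ v, 0 < cRes c ρ u v ∧ h v = n})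
      (by obtain ⟨v, hv⟩ := hRne; exact ⟨h v, v, hv, rfl⟩)
    obtain ⟨v, hv, hv2⟩ := hmem
    have := hmin v hv
    omega
  refine ⟨⟨by rw [hh'x s hus.symm, hhs], by rw [hh'x t hut.symm, hht], ?_⟩, hlt⟩
  intro a b hab
  by_cases hb : b = u
  · subst hb
    by_cases ha : a = b
    · subst ha; omega
    · have := hvalid a b hab
      rw [hh'x a ha]; omega
  · by_cases ha : a = u
    · subst ha
      have : sInf {n : ℕ | ∃ v, 0 < cRes c ρ a v ∧ h v = n} ≤ h b :=
        Nat.sInf_le ⟨b, hab, rfl⟩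
      rw [hh'x b hb]; omega
    · rw [hh'x a ha, hh'x b hb]; exact hvalid a b hab
end

section
/- Let V be a finite vertex set with capacities c, let ρ be a preflow, let V× ⊆ V, and let h : V× → ℕ be such that h(a) ≤ h(b) + 1 whenever (a,b) is V×-residual with respect to ρ. Let ℓ ≥ 1 be an integer and let U, W ⊆ V× satisfy h(u) = ℓ for every u ∈ U and h(w) = ℓ − 1 for every w ∈ W. Let P_1, …, P_m be simple directed paths, each starting at a vertex of U, ending at a vertex of W, and having all internal vertices outside V×, and let δ_1, …, δ_m > 0. Define g(x,y) = Σ_{i : (x,y) is an arc of P_i} δ_i, and assume g(x,y) ≤ c_ρ(x,y) for all x,y. Define ρ'(x,y) = max(0, ρ(x,y) + g(x,y) − ρ(y,x) − g(y,x)). Then 0 ≤ ρ'(x,y) ≤ c(x,y) for all x,y (so ρ' is a preflow), and for all a,b ∈ V×, if (a,b) is V×-residual with respect to ρ' then h(a) ≤ h(b) + 1. -/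
open Finset Classical

/-- `(a,b)` is `Vx`-residual with respect to `ρ`: there is a residual path from `a` to `b`
all of whose internal vertices avoid `Vx`. -/
def VxRes {V : Type*} (c ρ : V → V → ℝ) (Vx : Set V) (a b : V) : Prop :=
  ∃ (m : ℕ) (p : ℕ → V), p 0 = a ∧ p m = b ∧
    (∀ i < m, 0 < cRes c ρ (p i) (p (i + 1))) ∧
    (∀ i, 0 < i → i < m → p i ∉ Vx)

theorem VxRes_single {V : Type*} {c ρ : V → V → ℝ} {Vx : Set V} {x y : V}
    (hxy : 0 < cRes c ρ x y) : VxRes c ρ Vx x y := by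
  refine ⟨1, fun k => if k = 0 then x else y, by simp, by simp, ?_, ?_⟩
  · intro i hi
    obtain rfl : i = 0 := by omega
    simpa using hxy
  · intro i h0 h1
    omega

theorem VxRes_cons {V : Type*} {c ρ : V → V → ℝ} {Vx : Set V} {x y b : V}
    (hxy : 0 < cRes c ρ x y) (hy : y ∉ Vx) (hr : VxRes c ρ Vx y b) : VxRes c ρ Vx x b := by
  obtain ⟨n, p, h0, hn, hres, hint⟩ := hr
  refine ⟨n + 1, fun k => if k = 0 then x else p (k - 1), by simp, by simpa using hn, ?_, ?_⟩
  · intro i hi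
    rcases i with _ | i
    · simpa [h0] using hxy
    · simpa using hres i (by omega)
  · intro i hi0 hi
    rcases i with _ | i
    · omega
    · rcases Nat.eq_zero_or_pos i with rfl | hp
      · simpa [h0] using hy
      · simpa using hint i hp (by omega)

theorem VxRes_snoc {V : Type*} {c ρ : V → V → ℝ} {Vx : Set V} {a x y : V}
    (hr : VxRes c ρ Vx a x) (hx : x ∉ Vx) (hxy : 0 < cRes c ρ x y) : VxRes c ρ Vx a y := by
  obtain ⟨n, p, h0, hn, hres, hint⟩ := hr
  refine ⟨n + 1, fun k => if k ≤ n then p k else y, by simpa using h0, by simp, ?_, ?_⟩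
  · intro i hi
    rcases Nat.lt_or_ge i n with hl | hl
    · have h1 : i ≤ n := by omega
      have h2 : i + 1 ≤ n := by omega
      simpa only [h1, h2, if_true] using hres i hl
    · obtain rfl : i = n := by omega
      simpa [hn] using hxy
  · intro i hi0 hi
    have h1 : i ≤ n := by omega
    simp only [h1, if_true]
    rcases Nat.lt_or_ge i n with hl | hl
    · exact hint i hi0 hl
    · obtain rfl : i = n := by omega
      rwa [hn]

/-- Validity of the apex labeling is preserved by a `Bulk-Push` operation. -/
theorem stmt5 {V : Type*} [Fintype V] (c ρ : V → V → ℝ) (Vx : Set V) (h : V → ℕ)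
    (hc : ∀ u v, 0 ≤ c u v)
    (hρ : ∀ u v, 0 ≤ ρ u v ∧ ρ u v ≤ c u v)
    (hvalid : ∀ a ∈ Vx, ∀ b ∈ Vx, VxRes c ρ Vx a b → h a ≤ h b + 1)
    (ℓ : ℕ) (hℓ : 1 ≤ ℓ)
    (U W : Set V) (hUVx : U ⊆ Vx) (hWVx : W ⊆ Vx)
    (hhU : ∀ u ∈ U, h u = ℓ) (hhW : ∀ w ∈ W, h w = ℓ - 1)
    (m : ℕ) (len : Fin m → ℕ) (P : Fin m → ℕ → V) (δ : Fin m → ℝ)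
    (hlen : ∀ i, 1 ≤ len i)
    (hsimple : ∀ i, ∀ j ≤ len i, ∀ j' ≤ len i, P i j = P i j' → j = j')
    (hstart : ∀ i, P i 0 ∈ U)
    (hend : ∀ i, P i (len i) ∈ W)
    (hinternal : ∀ i j, 0 < j → j < len i → P i j ∉ Vx)
    (hδ : ∀ i, 0 < δ i)
    (g : V → V → ℝ)
    (hg : ∀ x y, g x y =
      ∑ i : Fin m, if ∃ j < len i, P i j = x ∧ P i (j + 1) = y then δ i else 0)
    (hgc : ∀ x y, g x y ≤ cRes c ρ x y)
    (ρ' : V → V → ℝ)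
    (hρ' : ∀ x y, ρ' x y = max 0 (ρ x y + g x y - ρ y x - g y x)) :
    (∀ x y, 0 ≤ ρ' x y ∧ ρ' x y ≤ c x y) ∧
    (∀ a ∈ Vx, ∀ b ∈ Vx, VxRes c ρ' Vx a b → h a ≤ h b + 1) := by
  have hg0 : ∀ x y, 0 ≤ g x y := by
    intro x y
    rw [hg]
    refine Finset.sum_nonneg fun i _ => ?_
    split_ifs
    · exact (hδ i).le
    · exact le_rfl
  have hcres : ∀ x y, cRes c ρ' x y = cRes c ρ x y - g x y + g y x := by
    intro x y
    simp only [cRes, hρ']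
    rcases le_total 0 (ρ x y + g x y - ρ y x - g y x) with hd | hd
    · rw [max_eq_right hd, max_eq_left (by linarith)]
      ring
    · rw [max_eq_left hd, max_eq_right (by linarith)]
      ring
  -- path arcs are residual with respect to `ρ`
  have harc : ∀ i j, j < len i → 0 < cRes c ρ (P i j) (P i (j + 1)) := by
    intro i j hj
    refine lt_of_lt_of_le ?_ (hgc _ _)
    rw [hg]
    refine Finset.sum_pos' ?_ ⟨i, Finset.mem_univ i, ?_⟩
    · intro i' _
      split_ifs
      · exact (hδ i').le
      · exact le_rfl
    · rw [if_pos ⟨j, hj, rfl, rfl⟩]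
      exact hδ i
  -- new residual arcs reverse a path arc
  have hnew : ∀ x y, 0 < cRes c ρ' x y → 0 < cRes c ρ x y ∨
      ∃ i j, j < len i ∧ P i j = y ∧ P i (j + 1) = x := by
    intro x y hxy
    by_contra hcon
    push Not at hcon
    obtain ⟨h1, h2⟩ := hcon
    have h3 : g y x = 0 := by
      rw [hg]
      refine Finset.sum_eq_zero fun i _ => if_neg ?_
      rintro ⟨j, hj, e1, e2⟩
      exact h2 i j hj e1 e2
    have := hcres x y
    have := hg0 x y
    linarith
  have htail : ∀ i j, j ≤ len i → VxRes c ρ Vx (P i j) (P i (len i)) := by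
    intro i j hj
    refine ⟨len i - j, fun k => P i (j + k), rfl, ?_, ?_, ?_⟩
    · show P i (j + (len i - j)) = _
      rw [Nat.add_sub_cancel' hj]
    · intro k hk
      exact harc i (j + k) (by omega)
    · intro k h0 hk
      exact hinternal i (j + k) (by omega) (by omega)
  have hhead : ∀ i j, j ≤ len i → VxRes c ρ Vx (P i 0) (P i j) := by
    intro i j hj
    exact ⟨j, P i, rfl, rfl, fun k hk => harc i k (by omega),
      fun k h0 hk => hinternal i k h0 (by omega)⟩
  refine ⟨?_, ?_⟩
  · intro x y
    rw [hρ']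
    refine ⟨le_max_left _ _, max_le (hc x y) ?_⟩
    have h1 := hgc x y
    have h2 := hg0 y x
    simp only [cRes] at h1
    linarith
  · rintro a ha b hb ⟨n, p, rfl, rfl, hres, hint⟩
    by_cases hab : VxRes c ρ Vx (p 0) (p n)
    · exact hvalid _ ha _ hb hab
    have hfwd : ∀ k, k ≤ n → VxRes c ρ Vx (p (n - k)) (p n) ∨
        ∃ w ∈ W, VxRes c ρ Vx (p (n - k)) w := by
      intro k
      induction k with
      | zero =>
        intro _
        exact Or.inl ⟨0, fun _ => p n, rfl, rfl, by simp, by simp⟩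
      | succ k ih =>
        intro hk
        have e : n - k = n - (k + 1) + 1 := by omega
        have hr := hres (n - (k + 1)) (by omega)
        rcases hnew _ _ hr with hr | ⟨i, j, hj, _, e2⟩
        · rcases Nat.eq_zero_or_pos k with rfl | hkp
          · left
            have := VxRes_single (Vx := Vx) hr
            rwa [← e] at this
          · rw [← e] at hr
            have hnv := hint (n - k) (by omega) (by omega)
            rcases ih (by omega) with h1 | ⟨w, hw, h1⟩
            · exact Or.inl (VxRes_cons hr hnv h1)
            · exact Or.inr ⟨w, hw, VxRes_cons hr hnv h1⟩
        · right
          rw [← e2]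
          exact ⟨_, hend i, htail i (j + 1) hj⟩
    have hbwd : ∀ k, k ≤ n → VxRes c ρ Vx (p 0) (p k) ∨
        ∃ u ∈ U, VxRes c ρ Vx u (p k) := by
      intro k
      induction k with
      | zero =>
        intro _
        exact Or.inl ⟨0, fun _ => p 0, rfl, rfl, by simp, by simp⟩
      | succ k ih =>
        intro hk
        have hr := hres k (by omega)
        rcases hnew _ _ hr with hr | ⟨i, j, hj, e1, _⟩
        · rcases Nat.eq_zero_or_pos k with rfl | hkp
          · exact Or.inl (VxRes_single hr)
          · have hnv := hint k hkp (by omega)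
            rcases ih (by omega) with h1 | ⟨u, hu, h1⟩
            · exact Or.inl (VxRes_snoc h1 hnv hr)
            · exact Or.inr ⟨u, hu, VxRes_snoc h1 hnv hr⟩
        · right
          rw [← e1]
          exact ⟨_, hstart i, hhead i j hj.le⟩
    have h1 := hfwd n le_rfl
    rw [Nat.sub_self] at h1
    rcases h1 with h1 | ⟨w, hw, h1⟩
    · exact absurd h1 hab
    rcases hbwd n le_rfl with h2 | ⟨u, hu, h2⟩
    · exact absurd h2 hab
    have h3 := hvalid _ ha _ (hWVx hw) h1
    have h4 := hvalid _ (hUVx hu) _ hb h2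
    rw [hhW w hw] at h3
    rw [hhU u hu] at h4
    omega
end

section
/- Let N, M, T be natural numbers and let x : {0, 1, …, N} → ℕ be a sequence with x(0) ≤ M, with x(i+1) ≠ x(i) for every i < N, and with Σ_{i < N} max(x(i+1) − x(i), 0) ≤ T. Then N ≤ M + 2T. -/
open Finset

/-- A counting bound on the number of pulses of the batch-highest-distance Push-Relabel
algorithm: a sequence of naturals starting at most `M`, never repeating consecutive values,
and with total increase at most `T`, has at most `M + 2T` steps. -/
theorem stmt6 (N M T : ℕ) (x : ℕ → ℕ)
    (h0 : x 0 ≤ M)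
    (hne : ∀ i < N, x (i + 1) ≠ x i)
    (hsum : ∑ i ∈ Finset.range N, max ((x (i + 1) : ℤ) - (x i : ℤ)) 0 ≤ (T : ℤ)) :
    N ≤ M + 2 * T := by
  have key : ∀ n ≤ N, (n : ℤ) + x n ≤
      x 0 + 2 * ∑ i ∈ Finset.range n, max ((x (i + 1) : ℤ) - (x i : ℤ)) 0 := by
    intro n
    induction n with
    | zero => intro _; simp
    | succ k ih =>
      intro hk
      have h1 := ih (by omega)
      have h2 := hne k (by omega)
      rw [Finset.sum_range_succ]
      push_cast
      omega
  have := key N le_rfl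
  omega
end
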